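/- arXiv:1112.4278 — 3 statements merged into one kernel-verified Lean document; each statement's English description precedes it below -/
import Mathlib

section
/- Let K be a compact topological space equipped with a finite Borel measure μ, let X and Y be Banach spaces, let 1 ≤ p < ∞. Let D be a Banach space and ι : D → X an injective bounded linear map (D playing the role of the common domain of definition equipped with the graph norm). Let A : K → L(D,Y) be continuous, and assume that for every x ∈ K the graph {(ι(d), A(x)d) : d ∈ D} is closed in X × Y. Then the shifted operator 𝐀, regarded as an unbounded linear operator from Lp(μ; X) to Lp(μ; Y) with domain {[ι ∘ U] : U ∈ Lp(μ; D)} and action 𝐀[ι ∘ U] = [x ↦ A(x)(U(x))], is a well-defined closed linear operator; that is, the set {([x ↦ ι(U(x))], [x ↦ A(x)(U(x))]) : U ∈ Lp(μ; D)} is a closed subspace of Lp(μ; X) × Lp(μ; Y). -/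
open MeasureTheory
open scoped ENNReal NNReal Topology


/-- A norm-continuous family of bounded-below operators on a compact space is uniformly
bounded below. -/
lemma exists_forall_norm_le_mul_norm_apply {𝕜 K D E : Type*} [TopologicalSpace K] [CompactSpace K]
    [NontriviallyNormedField 𝕜] [NormedAddCommGroup D] [NormedSpace 𝕜 D]
    [NormedAddCommGroup E] [NormedSpace 𝕜 E]
    {B : K → D →L[𝕜] E} (hB : Continuous B) (h : ∀ x, ∃ c, AntilipschitzWith c (B x)) :
    ∃ C : ℝ≥0, ∀ x d, ‖d‖ ≤ C * ‖B x d‖ := by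
  suffices H : ∃ C : ℝ≥0, ∀ x ∈ Set.univ, ∀ d, ‖d‖ ≤ C * ‖B x d‖ by simpa using H
  refine isCompact_univ.induction_on (p := fun s => ∃ C : ℝ≥0, ∀ x ∈ s, ∀ d, ‖d‖ ≤ C * ‖B x d‖)
    ⟨0, by simp⟩ ?_ ?_ ?_
  · rintro s t hst ⟨C, hC⟩
    exact ⟨C, fun x hx => hC x (hst hx)⟩
  · rintro s t ⟨C₁, h₁⟩ ⟨C₂, h₂⟩
    refine ⟨max C₁ C₂, ?_⟩
    rintro x (hx | hx) d
    · refine (h₁ x hx d).trans ?_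
      gcongr
      exact le_max_left _ _
    · refine (h₂ x hx d).trans ?_
      gcongr
      exact le_max_right _ _
  · intro x _
    obtain ⟨c, hc⟩ := h x
    have hev : ∀ᶠ y in 𝓝 x, c * ‖B y - B x‖ < 1 / 2 := by
      have : Continuous fun y => c * ‖B y - B x‖ := by fun_prop
      refine this.continuousAt.eventually_lt_const ?_
      simp
    refine ⟨_, mem_nhdsWithin_of_mem_nhds hev, 2 * c, fun y hy d => ?_⟩
    have hx : ‖d‖ ≤ c * ‖B x d‖ := (B x).bound_of_antilipschitz hc d
    have hsub : ‖B x d‖ ≤ ‖B y d‖ + ‖B y - B x‖ * ‖d‖ := by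
      have := (B y - B x).le_opNorm d
      rw [sub_apply] at this
      linarith [norm_sub_norm_le (B x d) (B y d), norm_sub_rev (B x d) (B y d)]
    have hmul : c * ‖B y - B x‖ * ‖d‖ ≤ 1 / 2 * ‖d‖ := by
      have : c * ‖B y - B x‖ < 1 / 2 := hy
      gcongr
    have := mul_le_mul_of_nonneg_left hsub c.coe_nonneg
    push_cast
    linarith

/-- A continuous function on a compact space is essentially bounded for every Borel measure. -/
lemma Continuous.memLp_top_of_compactSpace {K E : Type*} [TopologicalSpace K] [CompactSpace K]
    [MeasurableSpace K] [OpensMeasurableSpace K] [NormedAddCommGroup E] {f : K → E}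
    (hf : Continuous f) (μ : Measure K) : MemLp f ∞ μ :=
  hf.memLp_top_of_hasCompactSupport (.of_compactSpace f) μ

/-- An `Lp` function dominated pointwise by two others is dominated in norm by their sum. -/
lemma MeasureTheory.Lp.norm_le_mul_add_of_ae_le_mul_add {α E F G : Type*} [MeasurableSpace α]
    {μ : Measure α} {p : ℝ≥0∞} [Fact (1 ≤ p)] [NormedAddCommGroup E] [NormedAddCommGroup F]
    [NormedAddCommGroup G] {c : ℝ} {u : Lp E p μ} {f : Lp F p μ} {g : Lp G p μ}
    (h : ∀ᵐ x ∂μ, ‖u x‖ ≤ c * (‖f x‖ + ‖g x‖)) (hc : 0 ≤ c) :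
    ‖u‖ ≤ c * (‖f‖ + ‖g‖) := by
  let f' : Lp ℝ p μ := (Lp.memLp f).norm.toLp
  let g' : Lp ℝ p μ := (Lp.memLp g).norm.toLp
  have hf' : ‖f'‖ = ‖f‖ := by
    rw [Lp.norm_toLp, eLpNorm_norm, Lp.norm_def]
  have hg' : ‖g'‖ = ‖g‖ := by
    rw [Lp.norm_toLp, eLpNorm_norm, Lp.norm_def]
  have hu : ‖u‖ ≤ c * ‖f' + g'‖ := by
    refine Lp.norm_le_mul_norm_of_ae_le_mul ?_
    filter_upwards [h, Lp.coeFn_add f' g', (Lp.memLp f).norm.coeFn_toLp,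
      (Lp.memLp g).norm.coeFn_toLp] with x hx hadd hfx hgx
    rw [hadd, Pi.add_apply, hfx, hgx, Real.norm_of_nonneg (by positivity)]
    exact hx
  refine hu.trans ?_
  rw [← hf', ← hg']
  gcongr
  exact norm_add_le f' g'

/-- Let `K` be a compact topological space with a finite Borel measure `μ`,
`X`, `Y` Banach spaces, `1 ≤ p < ∞`. Let `D` be a Banach space, `ι : D → X` an injective
bounded linear map (the common domain of definition with the graph norm), and `A : K → L(D,Y)`
continuous such that each `A(x)` (viewed as an unbounded operator from `X` to `Y` with domain
`ι(D)`) is closed, i.e. the graph `{(ι d, A x d) : d ∈ D}` is closed in `X × Y`. Then the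
shifted operator `𝐀`, as an unbounded operator from `Lp(μ;X)` to `Lp(μ;Y)` with domain
`{[ι ∘ U] : U ∈ Lp(μ;D)}`, is a well-defined closed linear operator: its graph is closed. -/
theorem shifted_operator_closed
    {K : Type*} [TopologicalSpace K] [CompactSpace K] [MeasurableSpace K] [BorelSpace K]
    (μ : Measure K) [IsFiniteMeasure μ]
    {X Y D : Type*} [NormedAddCommGroup X] [NormedSpace ℝ X] [CompleteSpace X]
    [NormedAddCommGroup Y] [NormedSpace ℝ Y] [CompleteSpace Y]
    [NormedAddCommGroup D] [NormedSpace ℝ D] [CompleteSpace D]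
    (p : ℝ≥0∞) [Fact (1 ≤ p)] (hp : p ≠ ∞)
    (ι : D →L[ℝ] X) (hι : Function.Injective ι)
    (A : K → D →L[ℝ] Y) (hA : Continuous A)
    (hclosed : ∀ x : K, IsClosed {q : X × Y | ∃ d : D, q = (ι d, A x d)}) :
    IsClosed {q : Lp X p μ × Lp Y p μ | ∃ U : Lp D p μ,
      (q.1 : K → X) =ᵐ[μ] (fun x => ι (U x)) ∧
      (q.2 : K → Y) =ᵐ[μ] (fun x => A x (U x))} := by
  have hB : Continuous fun x => ι.prod (A x) :=
    (ContinuousLinearMap.prodₗᵢ ℝ).continuous.comp (continuous_const.prodMk hA)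
  obtain ⟨C, hC⟩ := exists_forall_norm_le_mul_norm_apply hB fun x =>
    (ι.prod (A x)).antilipschitz_of_injective_of_isClosed_range
      (fun d e h => hι (congrArg Prod.fst h)) (by
        have hrange : Set.range (ι.prod (A x)) = {q : X × Y | ∃ d : D, q = (ι d, A x d)} :=
          Set.ext fun q => exists_congr fun d => eq_comm
        exact hrange ▸ hclosed x)
  let A' : Lp (D →L[ℝ] Y) ∞ μ := (hA.memLp_top_of_compactSpace μ).toLp
  let L : Lp D p μ →L[ℝ] Lp Y p μ :=
    (ContinuousLinearMap.id ℝ (D →L[ℝ] Y)).holderL μ ∞ p p A'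
  have hL (U : Lp D p μ) : L U =ᵐ[μ] fun x => A x (U x) := by
    filter_upwards [(ContinuousLinearMap.id ℝ (D →L[ℝ] Y)).coeFn_holder (r := p) A' U,
      (hA.memLp_top_of_compactSpace μ).coeFn_toLp] with x hx hAx
    rw [← hAx]
    exact hx
  let T := (ι.compLpL p μ).prod L
  have hT : AntilipschitzWith (C * 2) T := by
    refine T.antilipschitz_of_bound fun U => ?_
    have hU : ‖U‖ ≤ C * (‖ι.compLpL p μ U‖ + ‖L U‖) := by
      refine Lp.norm_le_mul_add_of_ae_le_mul_add ?_ C.coe_nonneg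
      filter_upwards [ι.coeFn_compLpL (p := p) U, hL U] with x hιx hLx
      rw [hιx, hLx]
      refine (hC x (U x)).trans ?_
      gcongr
      exact max_le_add_of_nonneg (norm_nonneg _) (norm_nonneg _)
    refine hU.trans ?_
    push_cast
    rw [mul_assoc, two_mul]
    gcongr
    · exact norm_fst_le (T U)
    · exact norm_snd_le (T U)
  refine (congrArg IsClosed (Set.ext fun q => exists_congr fun U => ?_)).mp
    (hT.isClosed_range T.uniformContinuous)
  rw [Prod.ext_iff, Lp.ext_iff, Lp.ext_iff]
  exact and_congr
    ⟨fun h => h.symm.trans (ι.coeFn_compLpL U), fun h => (ι.coeFn_compLpL U).trans h.symm⟩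
    ⟨fun h => h.symm.trans (hL U), fun h => (hL U).trans h.symm⟩
end

section
/- Let K be a compact topological space equipped with a finite Borel measure μ, let X be a Banach space, let 1 ≤ p < ∞. Let D be a Banach space, ι : D → X an injective bounded linear map, and A : K → L(D,X) continuous. Assume there exist constants ω ∈ ℝ, θ ∈ (0, π) and M ≥ 1 such that for every x ∈ K and every λ in the sector S_{θ,ω} = {λ ∈ ℂ : λ ≠ ω and |arg(λ − ω)| < θ}, the operator λ·ι + A(x) : D → X is bijective and the bounded operator ι ∘ (λ·ι + A(x))⁻¹ ∈ L(X) satisfies ‖ι ∘ (λ·ι + A(x))⁻¹‖_{L(X)} ≤ M / |λ − ω|. Then for every λ ∈ S_{θ,ω} and every f ∈ Lp(μ; X) there exists a unique U ∈ Lp(μ; D) such that [x ↦ λ·ι(U(x)) + A(x)(U(x))] = f in Lp(μ; X), and this solution satisfies ‖[x ↦ ι(U(x))]‖_{Lp(μ;X)} ≤ (M / |λ − ω|) · ‖f‖_{Lp(μ;X)}. In other words, the shifted operator 𝐀 is sectorial in Lp(μ; X): the sector S_{θ,ω} is contained in the resolvent set of −𝐀 and the resolvent satisfies ‖(λ + 𝐀)⁻¹‖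 ≤ M / |λ − ω| there. -/
open MeasureTheory
open scoped ENNReal

/-- A continuous function on a compact space is strongly measurable, since its range is compact
and hence separable. -/
theorem Continuous.stronglyMeasurable_of_compactSpace {α β : Type*} [TopologicalSpace α]
    [CompactSpace α] [MeasurableSpace α] [OpensMeasurableSpace α] [TopologicalSpace β]
    [TopologicalSpace.PseudoMetrizableSpace β] {f : α → β} (hf : Continuous f) :
    StronglyMeasurable f := by
  let : MeasurableSpace β := borel β
  have : BorelSpace β := ⟨rfl⟩
  let := TopologicalSpace.pseudoMetrizableSpacePseudoMetric β
  exact stronglyMeasurable_iff_measurable_separable.2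
    ⟨hf.measurable, (isCompact_range hf).isSeparable⟩

/-- Inversion is continuous along a continuous family of invertible operators. -/
theorem Continuous.continuousLinearMap_inverse {α 𝕜 E F : Type*} [TopologicalSpace α]
    [NontriviallyNormedField 𝕜] [NormedAddCommGroup E] [NormedSpace 𝕜 E] [CompleteSpace E]
    [NormedAddCommGroup F] [NormedSpace 𝕜 F] {B : α → E →L[𝕜] F} (hB : Continuous B)
    (hinv : ∀ x, (B x).IsInvertible) : Continuous fun x => (B x).inverse := by
  refine continuous_iff_continuousAt.2 fun x => ?_
  obtain ⟨e, he⟩ := hinv x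
  have h : ContinuousAt ContinuousLinearMap.inverse (B x) :=
    he ▸ (contDiffAt_map_inverse (n := 0) e).continuousAt
  exact ContinuousAt.comp (f := B) h hB.continuousAt

/-- A continuous operator family on a compact space maps `Lp` functions to `Lp` functions. -/
theorem MeasureTheory.MemLp.continuous_clm_apply {α 𝕜 E F : Type*} [TopologicalSpace α]
    [CompactSpace α] [MeasurableSpace α] [OpensMeasurableSpace α] {μ : Measure α} {p : ℝ≥0∞}
    [NontriviallyNormedField 𝕜] [NormedAddCommGroup E] [NormedSpace 𝕜 E]
    [NormedAddCommGroup F] [NormedSpace 𝕜 F] {R : α → E →L[𝕜] F} (hR : Continuous R)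
    {f : α → E} (hf : MemLp f p μ) : MemLp (fun x => R x (f x)) p μ := by
  obtain ⟨C, hC⟩ := (isCompact_range hR).isBounded.exists_norm_le
  refine hf.of_le_mul (c := C) ?_ (.of_forall fun x => ?_)
  · exact (ContinuousLinearMap.id 𝕜 (E →L[𝕜] F)).aestronglyMeasurable_comp₂
      hR.stronglyMeasurable_of_compactSpace.aestronglyMeasurable hf.1
  · exact (R x).le_of_opNorm_le (hC _ ⟨x, rfl⟩) _

/-- Let `K` be a compact topological space with a finite Borel measure `μ`,
`X` a Banach space, `1 ≤ p < ∞`, `D` a Banach space, `ι : D → X` injective bounded linear,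
and `A : K → L(D,X)` continuous. Assume there are `ω ∈ ℝ`, `θ ∈ (0,π)`, `M ≥ 1` such that
for every `x ∈ K` and every `λ` in the sector `S_{θ,ω}` the operator `λ·ι + A(x) : D → X`
is bijective with `‖ι ∘ (λ·ι + A(x))⁻¹‖ ≤ M/|λ-ω|`. Then for every `λ ∈ S_{θ,ω}` and every
`f ∈ Lp(μ;X)` there is a unique `U ∈ Lp(μ;D)` with `[x ↦ λ·ι(U x) + A(x)(U x)] = f`, and
`‖[x ↦ ι(U x)]‖_{Lp} ≤ (M/|λ-ω|)·‖f‖_{Lp}`; i.e. the shifted operator `𝐀` is sectorial. -/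
theorem shifted_operator_sectorial
    {K : Type*} [TopologicalSpace K] [CompactSpace K] [MeasurableSpace K] [BorelSpace K]
    (μ : Measure K) [IsFiniteMeasure μ]
    {X D : Type*} [NormedAddCommGroup X] [NormedSpace ℂ X] [CompleteSpace X]
    [NormedAddCommGroup D] [NormedSpace ℂ D] [CompleteSpace D]
    (p : ℝ≥0∞) [Fact (1 ≤ p)] (hp : p ≠ ∞)
    (ι : D →L[ℂ] X) (hι : Function.Injective ι)
    (A : K → D →L[ℂ] X) (hA : Continuous A)
    (ω θ M : ℝ) (hθ : θ ∈ Set.Ioo 0 Real.pi) (hM : 1 ≤ M)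
    (hbij : ∀ x : K, ∀ z : ℂ, z ≠ (ω : ℂ) → |(z - (ω : ℂ)).arg| < θ →
      Function.Bijective (fun d : D => z • ι d + A x d))
    (hres : ∀ x : K, ∀ z : ℂ, z ≠ (ω : ℂ) → |(z - (ω : ℂ)).arg| < θ →
      ∀ d : D, ‖ι d‖ ≤ M / ‖z - (ω : ℂ)‖ * ‖z • ι d + A x d‖) :
    ∀ z : ℂ, z ≠ (ω : ℂ) → |(z - (ω : ℂ)).arg| < θ →
      ∀ f : Lp X p μ,
        (∃! U : Lp D p μ,
          (f : K → X) =ᵐ[μ] fun x => z • ι (U x) + A x (U x)) ∧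
        (∀ U : Lp D p μ,
          ((f : K → X) =ᵐ[μ] fun x => z • ι (U x) + A x (U x)) →
          eLpNorm (fun x => ι (U x)) p μ ≤
            ENNReal.ofReal (M / ‖z - (ω : ℂ)‖) * eLpNorm (f : K → X) p μ) := by
  intro z hz harg f
  let B : K → D →L[ℂ] X := fun x => z • ι + A x
  have hB : Continuous B := continuous_const.add hA
  have hinv : ∀ x, (B x).IsInvertible := fun x =>
    ⟨.ofBijective (B x) (LinearMap.ker_eq_bot.2 (hbij x z hz harg).1)
      (LinearMap.range_eq_top.2 (hbij x z hz harg).2), rfl⟩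
  have hmem : MemLp (fun x => (B x).inverse (f x)) p μ :=
    (Lp.memLp f).continuous_clm_apply (hB.continuousLinearMap_inverse hinv)
  refine ⟨⟨hmem.toLp _, ?_, fun V hV => Lp.ext ?_⟩, fun U hU => ?_⟩
  · filter_upwards [hmem.coeFn_toLp] with x hx
    rw [hx]
    exact ((hinv x).self_apply_inverse (f x)).symm
  · filter_upwards [hmem.coeFn_toLp, hV] with x hx hVx
    rw [hx, hVx]
    exact ((hinv x).inverse_apply_self (V x)).symm
  · refine eLpNorm_le_mul_eLpNorm_of_ae_le_mul ?_ p
    filter_upwards [hU] with x hx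
    rw [hx]
    exact hres x z hz harg (U x)
end

section
/- Let X and Z₀ be Banach spaces (the macroscopic and microscopic state spaces). Let D₁ be a Banach space continuously and injectively embedded in X via ι₁ : D₁ → X, and let Z₁ be a Banach space continuously and injectively embedded in Z₀ via j : Z₁ → Z₀. Let tr ∈ L(Z₁, X) (the matching trace), let R ∈ L(X, Z₁) be a bounded right inverse of tr (tr ∘ R = id_X), and let Ã₂ ∈ L(Z₁, Z₀) (the cell differential expression) satisfy Ã₂ ∘ R = 0. Let A₁ ∈ L(D₁, X). Fix θ ∈ (0, π) and constants M₁, M₂ ≥ 1, and assume that for every λ in the sector S_θ = {λ ∈ ℂ : λ ≠ 0, |arg λ| < θ}: (i) λ·ι₁ + A₁ : D₁ → X is bijective and ‖ι₁ ∘ (λ·ι₁ + A₁)⁻¹‖_{L(X)} ≤ M₁/|λ|; (ii) for every g ∈ Z₀ there is a unique W ∈ Z₁ with tr W = 0 and λ·j(W) + Ã₂(W) = g, and this W satisfies ‖j(W)‖_{Z₀} ≤ (M₂/|λ|)·‖g‖_{Z₀}. Then there exists a constant M ≥ 1 such that for every λ ∈ S_θ and every (f, g) ∈ X × Z₀ there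 exists a unique pair (u, U) with u ∈ D₁, U ∈ Z₁, tr U = ι₁(u), λ·ι₁(u) + A₁(u) = f and λ·j(U) + Ã₂(U) = g; moreover |λ|·(‖ι₁(u)‖_X + ‖j(U)‖_{Z₀}) ≤ M·(‖f‖_X + ‖g‖_{Z₀}). Consequently the coupled operator 𝐀(u,U) = (A₁u, Ã₂U), with domain {(u,U) : u ∈ D₁, U ∈ Z₁, tr U = ι₁(u)}, is sectorial in X × Z₀: the sector S_θ lies in the resolvent set of −𝐀 with resolvent bound M/|λ|. -/
/-- Abstract resolvent estimate for the coupled matched-microstructure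
operator (Proposition 8 of the paper). With macroscopic space `X`, microscopic space `Z₀`,
domains `D₁ ↪ X` (via `ι₁`) and `Z₁ ↪ Z₀` (via `j`), matching trace `tr ∈ L(Z₁,X)` with
bounded right inverse `R` satisfying `tr ∘ R = id` and `Ã₂ ∘ R = 0`, macroscopic operator
`A₁ ∈ L(D₁,X)` and cell operator `Ã₂ ∈ L(Z₁,Z₀)`: if `A₁` and the cell problem with
homogeneous matching condition satisfy resolvent estimates with constants `M₁, M₂ ≥ 1` on
the sector `S_θ = {λ ≠ 0, |arg λ| < θ}`, then the coupled operator
`𝐀(u,U) = (A₁u, Ã₂U)` with domain `{(u,U) : tr U = ι₁ u}` is sectorial in `X × Z₀`: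
there is `M ≥ 1` with unique solvability of `(λ + 𝐀)(u,U) = (f,g)` on `S_θ` and the
resolvent bound `|λ|(‖ι₁u‖ + ‖jU‖) ≤ M(‖f‖ + ‖g‖)`. -/
theorem coupled_operator_sectorial
    {X Z₀ D₁ Z₁ : Type*}
    [NormedAddCommGroup X] [NormedSpace ℂ X] [CompleteSpace X]
    [NormedAddCommGroup Z₀] [NormedSpace ℂ Z₀] [CompleteSpace Z₀]
    [NormedAddCommGroup D₁] [NormedSpace ℂ D₁] [CompleteSpace D₁]
    [NormedAddCommGroup Z₁] [NormedSpace ℂ Z₁] [CompleteSpace Z₁]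
    (ι₁ : D₁ →L[ℂ] X) (hι₁ : Function.Injective ι₁)
    (j : Z₁ →L[ℂ] Z₀) (hj : Function.Injective j)
    (tr : Z₁ →L[ℂ] X) (R : X →L[ℂ] Z₁)
    (htrR : tr.comp R = ContinuousLinearMap.id ℂ X)
    (A₂ : Z₁ →L[ℂ] Z₀) (hA₂R : A₂.comp R = 0)
    (A₁ : D₁ →L[ℂ] X)
    (θ : ℝ) (hθ : θ ∈ Set.Ioo 0 Real.pi)
    (M₁ M₂ : ℝ) (hM₁ : 1 ≤ M₁) (hM₂ : 1 ≤ M₂)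
    (h1 : ∀ z : ℂ, z ≠ 0 → |z.arg| < θ →
      Function.Bijective (fun d : D₁ => z • ι₁ d + A₁ d) ∧
      ∀ d : D₁, ‖ι₁ d‖ ≤ M₁ / ‖z‖ * ‖z • ι₁ d + A₁ d‖)
    (h2 : ∀ z : ℂ, z ≠ 0 → |z.arg| < θ →
      (∀ g : Z₀, ∃! W : Z₁, tr W = 0 ∧ z • j W + A₂ W = g) ∧
      ∀ W : Z₁, tr W = 0 → ‖j W‖ ≤ M₂ / ‖z‖ * ‖z • j W + A₂ W‖) :
    ∃ M : ℝ, 1 ≤ M ∧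
      ∀ z : ℂ, z ≠ 0 → |z.arg| < θ → ∀ f : X, ∀ g : Z₀,
        (∃! uU : D₁ × Z₁,
          tr uU.2 = ι₁ uU.1 ∧
          z • ι₁ uU.1 + A₁ uU.1 = f ∧
          z • j uU.2 + A₂ uU.2 = g) ∧
        (∀ (u : D₁) (U : Z₁), tr U = ι₁ u →
          z • ι₁ u + A₁ u = f → z • j U + A₂ U = g →
          ‖z‖ * (‖ι₁ u‖ + ‖j U‖) ≤ M * (‖f‖ + ‖g‖)) := by
  have htr : ∀ x, tr (R x) = x := fun x => DFunLike.congr_fun htrR x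
  have hA : ∀ x, A₂ (R x) = 0 := fun x => DFunLike.congr_fun hA₂R x
  have lift_eq : ∀ (z : ℂ) (U : Z₁) (x : X),
      z • j (U - R x) + A₂ (U - R x) = z • j U + A₂ U - z • j (R x) := by
    intro z U x
    rw [map_sub, map_sub, hA, smul_sub]
    abel
  set K := ‖j.comp R‖
  have hK : 0 ≤ K := norm_nonneg _
  have hjR : ∀ x, ‖j (R x)‖ ≤ K * ‖x‖ := (j.comp R).le_opNorm
  have hC : 0 ≤ (M₂ + 1) * K * M₁ := by positivity
  refine ⟨M₁ + M₂ + (M₂ + 1) * K * M₁, by linarith, fun z hz hzθ f g => ⟨?_, ?_⟩⟩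
  · obtain ⟨⟨hinj, hsurj⟩, -⟩ := h1 z hz hzθ
    obtain ⟨u, hu⟩ := hsurj f
    obtain ⟨W, ⟨hW0, hW⟩, hWuniq⟩ := (h2 z hz hzθ).1 (g - z • j (R (ι₁ u)))
    refine ⟨(u, W + R (ι₁ u)), ⟨by simp [hW0, htr], hu, ?_⟩, ?_⟩
    · have := lift_eq z (W + R (ι₁ u)) (ι₁ u)
      rw [add_sub_cancel_right, hW] at this
      exact (sub_left_injective this).symm
    · rintro ⟨v, V⟩ ⟨hV0, hv, hV⟩
      dsimp only at hV0 hv hV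
      obtain rfl : v = u := hinj (hv.trans hu.symm)
      have hVW := hWuniq (V - R (ι₁ v)) ⟨by simp [hV0, htr], by rw [lift_eq, hV]⟩
      rw [← hVW, sub_add_cancel]
  · intro u U hU hu hUg
    have hz' : 0 < ‖z‖ := norm_pos_iff.mpr hz
    have macro_bound : ‖z‖ * ‖ι₁ u‖ ≤ M₁ * ‖f‖ := by
      have h := (h1 z hz hzθ).2 u
      rwa [hu, div_mul_eq_mul_div, le_div_iff₀' hz'] at h
    have lift_bound : ‖z‖ * ‖j (R (ι₁ u))‖ ≤ K * (M₁ * ‖f‖) :=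
      calc ‖z‖ * ‖j (R (ι₁ u))‖ ≤ ‖z‖ * (K * ‖ι₁ u‖) := by gcongr; exact hjR _
        _ = K * (‖z‖ * ‖ι₁ u‖) := by ring
        _ ≤ K * (M₁ * ‖f‖) := by gcongr
    have cell_bound : ‖z‖ * ‖j (U - R (ι₁ u))‖ ≤ M₂ * (‖g‖ + K * (M₁ * ‖f‖)) := by
      have h := (h2 z hz hzθ).2 (U - R (ι₁ u)) (by simp [hU, htr])
      rw [lift_eq, hUg, div_mul_eq_mul_div, le_div_iff₀' hz'] at h
      refine h.trans ?_
      gcongr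
      refine (norm_sub_le _ _).trans ?_
      rw [norm_smul]
      gcongr
    have split_bound : ‖j U‖ ≤ ‖j (U - R (ι₁ u))‖ + ‖j (R (ι₁ u))‖ := by
      simpa using norm_add_le (j (U - R (ι₁ u))) (j (R (ι₁ u)))
    calc ‖z‖ * (‖ι₁ u‖ + ‖j U‖)
        ≤ ‖z‖ * (‖ι₁ u‖ + (‖j (U - R (ι₁ u))‖ + ‖j (R (ι₁ u))‖)) := by gcongr
      _ ≤ M₁ * ‖f‖ + (M₂ * (‖g‖ + K * (M₁ * ‖f‖)) + K * (M₁ * ‖f‖)) := by linarith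
      _ ≤ (M₁ + M₂ + (M₂ + 1) * K * M₁) * (‖f‖ + ‖g‖) := by
        have hf : 0 ≤ M₂ * ‖f‖ := by positivity
        have hg : 0 ≤ (M₁ + (M₂ + 1) * K * M₁) * ‖g‖ := by positivity
        linarith
end
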